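/- arXiv:1912.10214 — 4 statements merged into one kernel-verified Lean document; each statement's English description precedes it below -/
import Mathlib

section
/- Let f : ℕ → ℝ and c > 0 be such that for every j, k ∈ ℕ with j + k > 0 there exists ν ∈ [0,1] with ν ≤ c·j/(j+k) and f(j+k) ≤ ν·f(j) + (1−ν)·f(k). Then the limit of f(k) as k → ∞ exists and equals the infimum of f(k) over k ≥ 1. -/
/-- A function satisfying `f (k + m) ≤ max (f k) (f m)` is bounded by `f m` on the positive
multiples of `m`. -/
theorem apply_succ_mul_le_of_le_max {f : ℕ → ℝ} {m : ℕ}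
    (h : ∀ k, f (k + m) ≤ max (f k) (f m)) (q : ℕ) : f ((q + 1) * m) ≤ f m := by
  induction q with
  | zero => simp
  | succ q ih =>
    rw [Nat.succ_mul]
    exact (h _).trans (max_le ih le_rfl)

/-- **Generalized Fekete lemma.** If `f : ℕ → ℝ` satisfies: for all `j k` with
`j + k > 0` there is `ν ∈ [0,1]` with `ν ≤ c·j/(j+k)` and
`f (j+k) ≤ ν·f j + (1-ν)·f k`, then `f k` converges (in the extended reals,
so that divergence to `-∞` is allowed) to `inf_{k ≥ 1} f k`. -/
theorem fekete_convex (f : ℕ → ℝ) (c : ℝ) (hc : 0 < c)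
    (h : ∀ j k : ℕ, 0 < j + k → ∃ ν : ℝ, ν ∈ Set.Icc (0 : ℝ) 1 ∧
      ν ≤ c * j / (j + k) ∧ f (j + k) ≤ ν * f j + (1 - ν) * f k) :
    Filter.Tendsto (fun k => (f k : EReal)) Filter.atTop
      (nhds (⨅ k : {k : ℕ // 1 ≤ k}, (f k : EReal))) := by
  have hmax : ∀ j k : ℕ, 0 < k → f (j + k) ≤ max (f j) (f k) := by
    intro j k hk
    obtain ⟨ν, ⟨h0, h1⟩, -, hν⟩ := h j k (by omega)
    nlinarith [mul_le_mul_of_nonneg_left (le_max_left (f j) (f k)) h0,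
      mul_le_mul_of_nonneg_left (le_max_right (f j) (f k)) (sub_nonneg.2 h1)]
  have hmul : ∀ m, 0 < m → ∀ q, f ((q + 1) * m) ≤ f m := fun m hm =>
    apply_succ_mul_le_of_le_max fun k => hmax k m hm
  have hbdd : ∀ r, f r ≤ |f 0| + |f 1| := by
    intro r
    rcases r with _ | r
    · linarith [le_abs_self (f 0), abs_nonneg (f 1)]
    · have := hmul 1 one_pos r
      rw [mul_one] at this
      linarith [le_abs_self (f 1), abs_nonneg (f 0)]
  have hupper : ∀ m, 0 < m → ∀ n, m ≤ n →
      f n ≤ f m + c * m * (|f 0| + |f 1| + |f m|) / n := by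
    intro m hm n hmn
    have hn : (0 : ℝ) < n := by exact_mod_cast hm.trans_le hmn
    obtain ⟨q, hq⟩ : ∃ q, n / m = q + 1 :=
      Nat.exists_eq_succ_of_ne_zero (Nat.div_pos hmn hm).ne'
    have hdecomp : n % m + (q + 1) * m = n := by rw [← hq, Nat.mod_add_div']
    obtain ⟨ν, ⟨h0, h1⟩, hνc, hν⟩ := h (n % m) ((q + 1) * m) (by omega)
    rw [← Nat.cast_add, hdecomp] at hνc
    rw [hdecomp] at hν
    have hr : ((n % m : ℕ) : ℝ) ≤ m := by exact_mod_cast (Nat.mod_lt n hm).le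
    have hν' : ν ≤ c * m / n := hνc.trans (by gcongr)
    have hC : f (n % m) - f m ≤ |f 0| + |f 1| + |f m| := by
      linarith [hbdd (n % m), neg_abs_le (f m)]
    calc f n ≤ ν * f (n % m) + (1 - ν) * f m :=
          hν.trans (by gcongr; exact hmul m hm q)
      _ = f m + ν * (f (n % m) - f m) := by ring
      _ ≤ f m + ν * (|f 0| + |f 1| + |f m|) := by gcongr
      _ ≤ f m + c * m / n * (|f 0| + |f 1| + |f m|) := by gcongr
      _ = _ := by ring
  refine tendsto_order.2 ⟨fun a ha => ?_, fun a ha => ?_⟩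
  · filter_upwards [Filter.eventually_ge_atTop 1] with k hk
    exact ha.trans_le (iInf_le (fun k : {k : ℕ // 1 ≤ k} => (f k : EReal)) ⟨k, hk⟩)
  · obtain ⟨⟨m, hm⟩, hma⟩ := iInf_lt_iff.1 ha
    have hlim : Filter.Tendsto (fun n : ℕ => f m + c * m * (|f 0| + |f 1| + |f m|) / n)
        Filter.atTop (nhds (f m)) := by
      simpa using (tendsto_const_div_atTop_nhds_zero_nat _).const_add (f m)
    have hlim' := (continuous_coe_real_ereal.tendsto (f m)).comp hlim
    filter_upwards [hlim'.eventually (gt_mem_nhds hma), Filter.eventually_ge_atTop m]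
      with n hn hmn
    exact lt_of_le_of_lt (EReal.coe_le_coe_iff.2 (hupper m hm n hmn)) hn
end

section
/- Given a weighted system (𝒜, α) in which every matrix A_i is invertible, for all j, k ≥ 1 there exists ν ∈ (0,1) with ν ≤ (α_max/α_min)·j/(j+k) such that ρ_{j+k} ≤ ρ_j^{ν} · ρ_k^{1−ν}, where α_min and α_max denote the minimal and maximal weights. -/
open Filter

attribute [local instance] Matrix.linftyOpNormedRing

/-- The product `A(k)⋯A(1)` associated with the word `w = (i_1, …, i_k)`. -/
noncomputable def wordProd {d m : ℕ} (A : Fin m → Matrix (Fin d) (Fin d) ℝ)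
    (w : List (Fin m)) : Matrix (Fin d) (Fin d) ℝ :=
  ((w.map A).reverse).prod

/-- The total weight `α(k)+⋯+α(1)` of the word `w = (i_1, …, i_k)`. -/
def wordWeight {m : ℕ} (α : Fin m → ℝ) (w : List (Fin m)) : ℝ :=
  (w.map α).sum

/-- `ρ_k`: the maximum of `‖A(k)⋯A(1)‖^(1/(α(k)+⋯+α(1)))` over products of length `k`. -/
noncomputable def rhoSeq {d m : ℕ} (A : Fin m → Matrix (Fin d) (Fin d) ℝ)
    (α : Fin m → ℝ) (k : ℕ) : ℝ :=
  sSup {r : ℝ | ∃ w : List (Fin m), w.length = k ∧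
    r = ‖wordProd A w‖ ^ (1 / wordWeight α w)}

/-- The `α`-weighted joint spectral radius `ρ(𝒜, α) = limsup_{k→∞} ρ_k`. -/
noncomputable def wjsr {d m : ℕ} (A : Fin m → Matrix (Fin d) (Fin d) ℝ)
    (α : Fin m → ℝ) : ℝ :=
  limsup (rhoSeq A α) atTop

theorem wordProd_append {d m : ℕ} (A : Fin m → Matrix (Fin d) (Fin d) ℝ)
    (u v : List (Fin m)) : wordProd A (u ++ v) = wordProd A v * wordProd A u := by
  simp [wordProd]

theorem wordWeight_append {m : ℕ} (α : Fin m → ℝ) (u v : List (Fin m)) :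
    wordWeight α (u ++ v) = wordWeight α u + wordWeight α v := by
  simp [wordWeight]

theorem wordWeight_le {m : ℕ} {α : Fin m → ℝ} {c : ℝ} (h : ∀ i, α i ≤ c)
    (w : List (Fin m)) : wordWeight α w ≤ w.length * c := by
  simpa [wordWeight] using
    List.sum_le_card_nsmul (w.map α) c (by simpa using fun i _ => h i)

theorem le_wordWeight {m : ℕ} {α : Fin m → ℝ} {c : ℝ} (h : ∀ i, c ≤ α i)
    (w : List (Fin m)) : w.length * c ≤ wordWeight α w := by
  simpa [wordWeight] using
    List.card_nsmul_le_sum (w.map α) c (by simpa using fun i _ => h i)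

theorem finite_rhoSeq_set {d m : ℕ} (A : Fin m → Matrix (Fin d) (Fin d) ℝ)
    (α : Fin m → ℝ) (n : ℕ) :
    {r : ℝ | ∃ w : List (Fin m), w.length = n ∧
      r = ‖wordProd A w‖ ^ (1 / wordWeight α w)}.Finite := by
  refine ((List.finite_length_eq (Fin m) n).image
    fun w => ‖wordProd A w‖ ^ (1 / wordWeight α w)).subset ?_
  rintro r ⟨w, hw, rfl⟩
  exact ⟨w, hw, rfl⟩

theorem exists_rhoSeq_eq {d m : ℕ} (hm : 0 < m) (A : Fin m → Matrix (Fin d) (Fin d) ℝ)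
    (α : Fin m → ℝ) (n : ℕ) :
    ∃ w : List (Fin m), w.length = n ∧
      rhoSeq A α n = ‖wordProd A w‖ ^ (1 / wordWeight α w) :=
  Set.Nonempty.csSup_mem
    (s := {r : ℝ | ∃ w : List (Fin m), w.length = n ∧
      r = ‖wordProd A w‖ ^ (1 / wordWeight α w)})
    ⟨_, List.replicate n ⟨0, hm⟩, List.length_replicate, rfl⟩ (finite_rhoSeq_set A α n)

theorem rhoSeq_nonneg {d m : ℕ} (A : Fin m → Matrix (Fin d) (Fin d) ℝ)
    (α : Fin m → ℝ) (n : ℕ) : 0 ≤ rhoSeq A α n := by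
  refine Real.sSup_nonneg ?_
  rintro r ⟨w, -, rfl⟩
  exact Real.rpow_nonneg (norm_nonneg _) _

theorem norm_wordProd_le_rhoSeq_rpow {d m : ℕ} (A : Fin m → Matrix (Fin d) (Fin d) ℝ)
    (α : Fin m → ℝ) (w : List (Fin m)) (hw : 0 < wordWeight α w) :
    ‖wordProd A w‖ ≤ rhoSeq A α w.length ^ wordWeight α w := by
  have h : ‖wordProd A w‖ ^ (wordWeight α w)⁻¹ ≤ rhoSeq A α w.length :=
    le_csSup (finite_rhoSeq_set A α w.length).bddAbove ⟨w, rfl, by rw [one_div]⟩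
  exact (Real.rpow_inv_le_iff_of_pos (norm_nonneg _) (rhoSeq_nonneg A α _) hw).1 h

/-- For a weighted system with invertible matrices, `ρ_{j+k} ≤ ρ_j^ν · ρ_k^{1-ν}`
for some `ν ∈ (0,1)` with `ν ≤ (α_max/α_min)·j/(j+k)`. -/
theorem rhoSeq_convex_combination {d m : ℕ} (hm : 0 < m)
    (A : Fin m → Matrix (Fin d) (Fin d) ℝ) (hA : ∀ i, IsUnit (A i))
    (α : Fin m → ℝ) (hα : ∀ i, 0 < α i) (j k : ℕ) (hj : 1 ≤ j) (hk : 1 ≤ k) :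
    ∃ ν : ℝ, ν ∈ Set.Ioo (0 : ℝ) 1 ∧
      ν ≤ ((⨆ i, α i) / (⨅ i, α i)) * j / (j + k) ∧
      rhoSeq A α (j + k) ≤ rhoSeq A α j ^ ν * rhoSeq A α k ^ (1 - ν) := by
  have : Nonempty (Fin m) := ⟨⟨0, hm⟩⟩
  have hmax : ∀ i, α i ≤ ⨆ i, α i := le_ciSup (Set.finite_range α).bddAbove
  have hmin : ∀ i, ⨅ i, α i ≤ α i := ciInf_le (Set.finite_range α).bddBelow
  have hpos : 0 < ⨅ i, α i := by
    obtain ⟨i, hi⟩ := exists_eq_ciInf_of_finite (f := α)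
    exact hi ▸ hα i
  have hweight : ∀ w : List (Fin m), 1 ≤ w.length → 0 < wordWeight α w := fun w hw =>
    (mul_pos (by exact_mod_cast hw) hpos).trans_le (le_wordWeight hmin w)
  obtain ⟨w, hw, hρ⟩ := exists_rhoSeq_eq hm A α (j + k)
  obtain ⟨u, v, rfl, hu, hv⟩ : ∃ u v, w = u ++ v ∧ u.length = j ∧ v.length = k :=
    ⟨w.take j, w.drop j, (List.take_append_drop j w).symm, by simp [hw], by simp [hw]⟩
  have hu0 := hweight u (hu ▸ hj)
  have hv0 := hweight v (hv ▸ hk)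
  have hsum : 0 < wordWeight α u + wordWeight α v := add_pos hu0 hv0
  have hν : 1 - wordWeight α u / (wordWeight α u + wordWeight α v) =
      wordWeight α v / (wordWeight α u + wordWeight α v) := by
    field_simp
    ring
  refine ⟨wordWeight α u / (wordWeight α u + wordWeight α v),
    ⟨div_pos hu0 hsum, (div_lt_one hsum).2 (by linarith)⟩, ?_, ?_⟩
  · have hle := wordWeight_le hmax u
    have hge := le_wordWeight hmin (u ++ v)
    rw [hw, wordWeight_append] at hge
    rw [hu] at hle
    push_cast at hge
    have hjk : (0 : ℝ) < j + k := by positivity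
    calc wordWeight α u / (wordWeight α u + wordWeight α v)
        ≤ (j * ⨆ i, α i) / ((j + k) * ⨅ i, α i) :=
          div_le_div₀ (hu0.le.trans hle) hle (mul_pos hjk hpos) hge
      _ = ((⨆ i, α i) / (⨅ i, α i)) * j / (j + k) := by
          field_simp
  · have hPu := norm_wordProd_le_rhoSeq_rpow A α u hu0
    have hPv := norm_wordProd_le_rhoSeq_rpow A α v hv0
    rw [hu] at hPu
    rw [hv] at hPv
    have hj0 := rhoSeq_nonneg A α j
    have hk0 := rhoSeq_nonneg A α k
    rw [hρ, wordProd_append, wordWeight_append, hν]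
    calc ‖wordProd A v * wordProd A u‖ ^ (1 / (wordWeight α u + wordWeight α v))
        ≤ (rhoSeq A α j ^ wordWeight α u * rhoSeq A α k ^ wordWeight α v) ^
            (1 / (wordWeight α u + wordWeight α v)) := by
          refine Real.rpow_le_rpow (norm_nonneg _) ?_ (by positivity)
          rw [mul_comm (rhoSeq A α j ^ _)]
          exact (norm_mul_le _ _).trans (mul_le_mul hPv hPu (norm_nonneg _) (by positivity))
      _ = _ := by
          rw [Real.mul_rpow (by positivity) (by positivity), ← Real.rpow_mul hj0,
            ← Real.rpow_mul hk0, mul_one_div, mul_one_div]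
end

section
/- Let A_1 = [[3, 1], [0, 3]] and A_2 = [[2, 0], [0, 2]] be real 2×2 matrices and 𝒜 = {A_1, A_2}. Then: (i) the weighted system (𝒜, (1,1)) is defective, i.e., there is no constant C > 0 such that ‖A(k)⋯A(1)‖ ≤ C·3^k for all k ≥ 1 and all choices A(j) ∈ 𝒜 (indeed 3^{−k}‖A_1^k‖ is unbounded in k); and (ii) the weighted system (𝒜, (2,1)) (weight 2 for A_1, weight 1 for A_2) is non-defective, i.e., there exists C > 0 such that ‖A(k)⋯A(1)‖ ≤ C·2^{α(k)+⋯+α(1)} for all k ≥ 1 and all choices A(j) ∈ 𝒜, where α(j) = 2 if A(j) = A_1 and α(j) = 1 if A(j) = A_2. -/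
open Filter

attribute [local instance] Matrix.linftyOpNormedRing

theorem wordProd_cons {d m : ℕ} (A : Fin m → Matrix (Fin d) (Fin d) ℝ) (i : Fin m)
    (w : List (Fin m)) : wordProd A (i :: w) = wordProd A w * A i := by
  simp [wordProd]

theorem wordWeight_cons {m : ℕ} (α : Fin m → ℝ) (i : Fin m) (w : List (Fin m)) :
    wordWeight α (i :: w) = α i + wordWeight α w := by
  simp [wordWeight]

theorem linfty_norm_upper_toeplitz {a b : ℝ} (ha : 0 ≤ a) (hb : 0 ≤ b) :
    ‖(!![a, b; 0, a] : Matrix (Fin 2) (Fin 2) ℝ)‖ = a + b := by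
  rw [Matrix.linfty_opNorm_def]
  have h : (Finset.univ : Finset (Fin 2)).sup
      (fun i => ∑ j, ‖(!![a, b; 0, a] : Matrix (Fin 2) (Fin 2) ℝ) i j‖₊) = ‖a‖₊ + ‖b‖₊ := by
    simp [Fin.univ_succ]
  rw [h]
  simp [abs_of_nonneg ha, abs_of_nonneg hb]

theorem wordProd_replicate_zero (k : ℕ) :
    wordProd ![!![(3 : ℝ), 1; 0, 3], !![(2 : ℝ), 0; 0, 2]] (List.replicate k 0) =
      !![(3 : ℝ) ^ k, k * 3 ^ k / 3; 0, 3 ^ k] := by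
  induction k with
  | zero => simp [wordProd, Matrix.one_fin_two]
  | succ k ih =>
    rw [List.replicate_succ, wordProd_cons, ih]
    ext i j
    fin_cases i <;> fin_cases j <;> simp [Matrix.mul_apply, Fin.sum_univ_two] <;> ring

theorem wordProd_eq_upper_toeplitz (w : List (Fin 2)) :
    ∃ a b : ℝ, 0 ≤ a ∧ 0 ≤ b ∧ a + b ≤ (2 : ℝ) ^ wordWeight ![(2 : ℝ), 1] w ∧
      wordProd ![!![(3 : ℝ), 1; 0, 3], !![(2 : ℝ), 0; 0, 2]] w = !![a, b; 0, a] := by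
  induction w with
  | nil => exact ⟨1, 0, by simp [wordProd, wordWeight, Matrix.one_fin_two]⟩
  | cons i w ih =>
    obtain ⟨a, b, ha, hb, hab, h⟩ := ih
    rw [wordProd_cons, wordWeight_cons, h, Real.rpow_add two_pos]
    match i with
    | 0 =>
      refine ⟨3 * a, a + 3 * b, by positivity, by positivity, ?_, ?_⟩
      · norm_num
        linarith
      · ext i j
        fin_cases i <;> fin_cases j <;> simp [Matrix.mul_apply, Fin.sum_univ_two] <;> ring
    | 1 =>
      refine ⟨2 * a, 2 * b, by positivity, by positivity, ?_, ?_⟩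
      · norm_num
        linarith
      · ext i j
        fin_cases i <;> fin_cases j <;> simp [Matrix.mul_apply, Fin.sum_univ_two] <;> ring

/-- For `A₁ = [[3,1],[0,3]]`, `A₂ = [[2,0],[0,2]]`:
(i) the weighted system `(𝒜, (1,1))` is defective — no `C > 0` satisfies
`‖A(k)⋯A(1)‖ ≤ C·3^{α(k)+⋯+α(1)}` for all nonempty products —
(ii) while `(𝒜, (2,1))` is non-defective — some `C > 0` satisfies
`‖A(k)⋯A(1)‖ ≤ C·2^{α(k)+⋯+α(1)}` for all nonempty products. -/
theorem example_defective_and_nondefective :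
    (¬ ∃ C : ℝ, 0 < C ∧ ∀ w : List (Fin 2), w ≠ [] →
      ‖wordProd ![!![(3 : ℝ), 1; 0, 3], !![(2 : ℝ), 0; 0, 2]] w‖ ≤
        C * (3 : ℝ) ^ wordWeight ![(1 : ℝ), 1] w) ∧
    (∃ C : ℝ, 0 < C ∧ ∀ w : List (Fin 2), w ≠ [] →
      ‖wordProd ![!![(3 : ℝ), 1; 0, 3], !![(2 : ℝ), 0; 0, 2]] w‖ ≤
        C * (2 : ℝ) ^ wordWeight ![(2 : ℝ), 1] w) := by
  constructor
  · rintro ⟨C, -, hC⟩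
    obtain ⟨k, hk⟩ := exists_nat_gt (3 * C)
    have h := hC (List.replicate (k + 1) 0) (by simp)
    have hw : wordWeight ![(1 : ℝ), 1] (List.replicate (k + 1) 0) = ((k + 1 : ℕ) : ℝ) := by
      simp [wordWeight]
    rw [wordProd_replicate_zero, linfty_norm_upper_toeplitz (by positivity) (by positivity), hw,
      Real.rpow_natCast] at h
    have h3 : (0 : ℝ) < 3 ^ (k + 1) := by positivity
    push_cast at h
    nlinarith
  · refine ⟨1, one_pos, fun w _ => ?_⟩
    obtain ⟨a, b, ha, hb, hab, h⟩ := wordProd_eq_upper_toeplitz w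
    rw [h, linfty_norm_upper_toeplitz ha hb, one_mul]
    exact hab
end

section
/- Let G be a finite directed multigraph with nonempty vertex set, where each vertex i carries a finite-dimensional real normed vector space L_i, and each edge e from vertex i to vertex j carries a linear map A_e : L_i → L_j and a strictly positive weight α_e. Assume G is strongly connected (for every ordered pair of vertices there is a directed path from the first to the second) and has at least one edge. For k ≥ 1, let r_k be the maximum over all directed paths ω = (e_1, …, e_k) of length k of ‖A_{e_k} ∘ ⋯ ∘ A_{e_1}‖^{1/(α_{e_1}+⋯+α_{e_k})}, where ‖·‖ denotes the operator norm between the corresponding spaces. Then the sequence (r_k) converges as k → ∞. -/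
open Filter

/-- The supremum of the weighted norms `‖B eₖ * ⋯ * B e₁‖ ^ (1 / (α e₁ + ⋯ + α eₖ))` over the
words of length `k` satisfying `Q`. -/
noncomputable def weightedRadius {E R : Type*} [NormedRing R] (Q : List E → Prop) (B : E → R)
    (α : E → ℝ) (k : ℕ) : ℝ :=
  sSup {s : ℝ | ∃ p : List E, p.length = k ∧ Q p ∧
    s = ‖((p.map B).reverse).prod‖ ^ (1 / (p.map α).sum)}

section WeightedRadius

variable {E R : Type*} [NormedRing R] {Q : List E → Prop} {B : E → R} {α : E → ℝ}

theorem weightedRadius_nonneg (k : ℕ) : 0 ≤ weightedRadius Q B α k := by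
  refine Real.sSup_nonneg ?_
  rintro s ⟨p, -, -, rfl⟩
  positivity

theorem weightedRadius_le {k : ℕ} {c : ℝ} (hc : 0 ≤ c)
    (h : ∀ p : List E, p.length = k → Q p →
      ‖((p.map B).reverse).prod‖ ^ (1 / (p.map α).sum) ≤ c) :
    weightedRadius Q B α k ≤ c := by
  refine Real.sSup_le ?_ hc
  rintro s ⟨p, hp, hQ, rfl⟩
  exact h p hp hQ

theorem length_mul_le_sum_map {a : ℝ} (ha : ∀ e, a ≤ α e) (p : List E) :
    p.length * a ≤ (p.map α).sum := by
  simpa using List.card_nsmul_le_sum (p.map α) a (by simpa using fun e _ => ha e)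

theorem sum_map_pos (hα : ∀ e, 0 < α e) {p : List E} (hp : p ≠ []) : 0 < (p.map α).sum := by
  refine List.sum_pos _ (by simpa using fun e _ => hα e) (by simpa using hp)

variable [Finite E]

theorem norm_prod_le_weightedRadius_rpow (hα : ∀ e, 0 < α e) {p : List E} (hp : p ≠ [])
    (hQ : Q p) :
    ‖((p.map B).reverse).prod‖ ≤ weightedRadius Q B α p.length ^ (p.map α).sum := by
  have hs := sum_map_pos hα hp
  have hbdd : BddAbove {s : ℝ | ∃ q : List E, q.length = p.length ∧ Q q ∧
      s = ‖((q.map B).reverse).prod‖ ^ (1 / (q.map α).sum)} := by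
    refine (((List.finite_length_eq E p.length).image fun q =>
      ‖((q.map B).reverse).prod‖ ^ (1 / (q.map α).sum)).subset ?_).bddAbove
    rintro s ⟨q, hq, -, rfl⟩
    exact ⟨q, hq, rfl⟩
  have hle : ‖((p.map B).reverse).prod‖ ^ (1 / (p.map α).sum) ≤ weightedRadius Q B α p.length :=
    le_csSup hbdd ⟨p, rfl, hQ, rfl⟩
  calc ‖((p.map B).reverse).prod‖
      = (‖((p.map B).reverse).prod‖ ^ (1 / (p.map α).sum)) ^ (p.map α).sum := by
        rw [← Real.rpow_mul (norm_nonneg _), one_div_mul_cancel hs.ne', Real.rpow_one]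
    _ ≤ _ := Real.rpow_le_rpow (by positivity) hle hs.le

/-- A number exceeding one term of the sequence `weightedRadius` bounds the exponential growth
of all products. -/
theorem exists_norm_prod_le_mul_rpow (hα : ∀ e, 0 < α e)
    (htake : ∀ p n, Q p → Q (p.take n)) (hdrop : ∀ p n, Q p → Q (p.drop n))
    {k : ℕ} (hk : k ≠ 0) {c : ℝ} (hc : weightedRadius Q B α k < c) :
    ∃ K : ℝ, 1 ≤ K ∧ ∀ p : List E, Q p →
      ‖((p.map B).reverse).prod‖ ≤ K * c ^ (p.map α).sum := by
  have hc0 : 0 < c := (weightedRadius_nonneg k).trans_lt hc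
  obtain ⟨K, hK⟩ := ((List.finite_length_lt E k).image fun p =>
    ‖((p.map B).reverse).prod‖ / c ^ (p.map α).sum).bddAbove
  refine ⟨max K 1, le_max_right _ _, fun p => ?_⟩
  induction hn : p.length using Nat.strong_induction_on generalizing p with
  | _ n ih =>
    intro hQ
    rcases lt_or_ge p.length k with hlt | hge
    · rw [← div_le_iff₀ (by positivity)]
      exact (hK ⟨p, hlt, rfl⟩).trans (le_max_left _ _)
    · have hlen : (p.take k).length = k := by simpa using hge
      have hne : p.take k ≠ [] := by
        intro h
        simp [h] at hlen
        omega
      have h₁ := norm_prod_le_weightedRadius_rpow (B := B) hα hne (htake p k hQ)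
      rw [hlen] at h₁
      have h₂ := h₁.trans (Real.rpow_le_rpow (weightedRadius_nonneg k) hc.le
        (sum_map_pos hα hne).le)
      have h₃ := ih (p.drop k).length (by rw [List.length_drop]; omega) _ rfl (hdrop p k hQ)
      calc ‖((p.map B).reverse).prod‖
          = ‖(((p.drop k).map B).reverse).prod * (((p.take k).map B).reverse).prod‖ := by
            rw [← List.prod_append, ← List.reverse_append, ← List.map_append,
              List.take_append_drop]
        _ ≤ (max K 1 * c ^ ((p.drop k).map α).sum) * c ^ ((p.take k).map α).sum :=
            (norm_mul_le _ _).trans (by gcongr)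
        _ = max K 1 * c ^ (p.map α).sum := by
            rw [mul_assoc, ← Real.rpow_add hc0, add_comm, ← List.sum_append, ← List.map_append,
              List.take_append_drop]

theorem eventually_weightedRadius_lt [Nonempty E] (hα : ∀ e, 0 < α e)
    (htake : ∀ p n, Q p → Q (p.take n)) (hdrop : ∀ p n, Q p → Q (p.drop n))
    {k : ℕ} (hk : k ≠ 0) {d : ℝ} (hd : weightedRadius Q B α k < d) :
    ∀ᶠ n in atTop, weightedRadius Q B α n < d := by
  obtain ⟨c, hc, hcd⟩ := exists_between hd
  have hc0 : 0 < c := (weightedRadius_nonneg k).trans_lt hc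
  obtain ⟨K, hK1, hK⟩ := exists_norm_prod_le_mul_rpow hα htake hdrop hk hc
  have hK0 : 0 < K := one_pos.trans_le hK1
  obtain ⟨e₀, he₀⟩ := Finite.exists_min α
  have hlim : Tendsto (fun n : ℕ => K ^ (1 / (n * α e₀)) * c) atTop (nhds c) := by
    have h₁ : Tendsto (fun n : ℕ => 1 / (n * α e₀)) atTop (nhds 0) := by
      simp only [one_div]
      exact (tendsto_natCast_atTop_atTop.atTop_mul_const (hα e₀)).inv_tendsto_atTop
    simpa using ((Real.continuousAt_const_rpow hK0.ne').tendsto.comp h₁).mul_const c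
  filter_upwards [hlim.eventually_lt_const hcd, eventually_ne_atTop 0] with n hn hn0
  refine lt_of_le_of_lt (weightedRadius_le (by positivity) fun p hp hQ => ?_) hn
  have hs : 0 < (p.map α).sum := sum_map_pos hα (by rintro rfl; exact hn0 hp.symm)
  have hsn := length_mul_le_sum_map he₀ p
  rw [hp] at hsn
  have hpos : 0 < n * α e₀ := mul_pos (by positivity) (hα e₀)
  calc ‖((p.map B).reverse).prod‖ ^ (1 / (p.map α).sum)
      ≤ (K * c ^ (p.map α).sum) ^ (1 / (p.map α).sum) :=
        Real.rpow_le_rpow (norm_nonneg _) (hK p hQ) (by positivity)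
    _ = K ^ (1 / (p.map α).sum) * c := by
        rw [Real.mul_rpow (by positivity) (by positivity), ← Real.rpow_mul hc0.le,
          mul_one_div_cancel hs.ne', Real.rpow_one]
    _ ≤ K ^ (1 / (n * α e₀)) * c := by gcongr

/-- Fekete-type convergence: the weighted radii converge to their infimum over positive
lengths. -/
theorem tendsto_weightedRadius [Nonempty E] (hα : ∀ e, 0 < α e)
    (htake : ∀ p n, Q p → Q (p.take n)) (hdrop : ∀ p n, Q p → Q (p.drop n)) :
    Tendsto (weightedRadius Q B α) atTop
      (nhds (sInf (weightedRadius Q B α '' {k | k ≠ 0}))) := by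
  have hbdd : BddBelow (weightedRadius Q B α '' {k | k ≠ 0}) := by
    refine ⟨0, ?_⟩
    rintro _ ⟨k, -, rfl⟩
    exact weightedRadius_nonneg k
  rw [tendsto_order]
  refine ⟨fun a ha => ?_, fun d hd => ?_⟩
  · filter_upwards [eventually_ne_atTop 0] with n hn
    exact ha.trans_le (csInf_le hbdd ⟨n, hn, rfl⟩)
  · have hne : (weightedRadius Q B α '' {k | k ≠ 0}).Nonempty := ⟨_, 1, one_ne_zero, rfl⟩
    obtain ⟨_, ⟨k, hk, rfl⟩, hkd⟩ := exists_lt_of_csInf_lt hne hd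
    exact eventually_weightedRadius_lt hα htake hdrop hk hkd

end WeightedRadius

/-- **Section 4.1.** For a weighted discrete-time system on a finite, strongly
connected directed multigraph (vertices carrying finite-dimensional real normed
spaces, edges carrying linear maps with positive weights), the sequence
`r_k = max over composable paths ω of length k of ‖A_{e_k} ∘ ⋯ ∘ A_{e_1}‖^{1/|ω|}`
converges as `k → ∞`. (Each edge map is encoded as the block operator, extended
by zero, on the product space `Π v, L v` equipped with the sup norm; the operator
norm of a composition along a composable path then coincides with the operator
norm of the composition between the corresponding spaces.) -/
theorem graph_rhoSeq_converges
    {V : Type*} [Fintype V] [Nonempty V] [DecidableEq V]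
    {E : Type*} [Fintype E] [Nonempty E]
    (src tgt : E → V)
    (L : V → Type*) [∀ v, NormedAddCommGroup (L v)] [∀ v, NormedSpace ℝ (L v)]
    [∀ v, FiniteDimensional ℝ (L v)]
    (A : ∀ e : E, L (src e) →ₗ[ℝ] L (tgt e))
    (α : E → ℝ) (hα : ∀ e, 0 < α e)
    (hconn : ∀ u v : V, ∃ p : List E, ∃ hp : p ≠ [],
      List.Chain' (fun e f => tgt e = src f) p ∧
      src (p.head hp) = u ∧ tgt (p.getLast hp) = v) :
    ∃ r : ℝ, Filter.Tendsto
      (fun k => sSup {s : ℝ | ∃ p : List E, p.length = k ∧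
        List.Chain' (fun e f => tgt e = src f) p ∧
        s = ‖((p.map (fun e => LinearMap.toContinuousLinearMap
            ((LinearMap.single ℝ L (tgt e)).comp
              ((A e).comp (LinearMap.proj (src e)))))).reverse).prod‖ ^
          (1 / (p.map α).sum)})
      Filter.atTop (nhds r) := by
  exact ⟨_, tendsto_weightedRadius (Q := List.IsChain fun e f => tgt e = src f) hα
    (fun _ n h => List.IsChain.take h n) (fun _ n h => List.IsChain.drop h n)⟩
end
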